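/- arXiv:2209.00283 — 2 statements merged into one kernel-verified Lean document; each statement's English description precedes it below -/
import Mathlib

section
/- The three minima coincide and are attained: min over (q,r) ∈ K_q × K_r of φ(q,r) = min over q ∈ K_q of φ_q(q) = min over r ∈ K_r of φ_r(r) (as values in the extended reals [0,+∞]). -/
noncomputable section

open Finset

variable {X Y J : Type*}

/-- `f(u,v) = u·log u − u·log v` with the conventions `f(0,v) = 0` and `f(u,0) = +∞` for `u > 0`,
taking values in the extended reals. -/
def fdiv (u v : ℝ) : EReal :=
  if u = 0 then 0
  else if v = 0 then (⊤ : EReal)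
  else ((u * Real.log u - u * Real.log v : ℝ) : EReal)

/-- Marginal `p_x := ∑_y p_{x,y}`. -/
def margX [Fintype Y] (p : X → Y → ℝ) (x : X) : ℝ := ∑ y, p x y

/-- Marginal `p^y := ∑_x p_{x,y}`. -/
def margY [Fintype X] (p : X → Y → ℝ) (y : Y) : ℝ := ∑ x, p x y

/-- The polytope `K_q`: `q_{j|x} ≥ 0`, `∑_{j∋x} q_{j|x} = 1` for every `x`,
and `q_{j|x} = 0` whenever `x ∉ j`. -/
def Kq [Fintype J] [DecidableEq X] (S : J → Finset X) : Set (J → X → ℝ) :=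
  {q | (∀ j x, 0 ≤ q j x) ∧ (∀ x, (∑ j, if x ∈ S j then q j x else 0) = 1) ∧
    (∀ j x, x ∉ S j → q j x = 0)}

/-- The polytope `K_r`: `r_{j|y} ≥ 0` and `∑_j r_{j|y} = 1` for every `y`. -/
def Kr (J Y : Type*) [Fintype J] : Set (J → Y → ℝ) :=
  {r | (∀ j y, 0 ≤ r j y) ∧ ∀ y, (∑ j, r j y) = 1}

/-- `φ(q,r) := ∑_{x,y,j} p_{x,y} · f(q_{j|x}, r_{j|y})`, extended-real valued. -/
def phi [Fintype X] [Fintype Y] [Fintype J] (p : X → Y → ℝ)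
    (q : J → X → ℝ) (r : J → Y → ℝ) : EReal :=
  ∑ x, ∑ y, ∑ j, (p x y : EReal) * fdiv (q j x) (r j y)

/-- `δ(q,q') := ∑_x p_x ∑_{j∋x} f(q_{j|x}, q'_{j|x})`, extended-real valued. -/
def delta [Fintype X] [Fintype Y] [Fintype J] [DecidableEq X] (p : X → Y → ℝ)
    (S : J → Finset X) (q q' : J → X → ℝ) : EReal :=
  ∑ x, (margX p x : EReal) * ∑ j, (if x ∈ S j then fdiv (q j x) (q' j x) else 0)

/-- `R_{j|y}(q) := ∑_{x∈j} p_{x|y} q_{j|x}`. -/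
def Rmap [Fintype X] [Fintype Y] [DecidableEq X] (p : X → Y → ℝ) (S : J → Finset X)
    (q : J → X → ℝ) : J → Y → ℝ :=
  fun j y => ∑ x, if x ∈ S j then (p x y / margY p y) * q j x else 0

/-- `A_x(r) := ∑_{j∋x} ∏_y (r_{j|y})^{p^{y|x}}` (real powers, with `0^0 = 1`). -/
def Afun [Fintype Y] [Fintype J] [DecidableEq X] (p : X → Y → ℝ) (S : J → Finset X)
    (r : J → Y → ℝ) (x : X) : ℝ :=
  ∑ j, if x ∈ S j then (∏ y, r j y ^ (p x y / margX p x)) else 0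

/-- `Q_{j|x}(r) := (∏_y (r_{j|y})^{p^{y|x}}) / A_x(r)` if `x ∈ j`, and `0` otherwise. -/
def Qmap [Fintype Y] [Fintype J] [DecidableEq X] (p : X → Y → ℝ) (S : J → Finset X)
    (r : J → Y → ℝ) : J → X → ℝ :=
  fun j x => if x ∈ S j then (∏ y, r j y ^ (p x y / margX p x)) / Afun p S r x else 0

open Classical in
/-- `φ_r(r) := −∑_x p_x log A_x(r)`, equal to `+∞` if `A_x(r) = 0` for some `x`. -/
def phiR [Fintype X] [Fintype Y] [Fintype J] [DecidableEq X] (p : X → Y → ℝ)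
    (S : J → Finset X) (r : J → Y → ℝ) : EReal :=
  if ∃ x, Afun p S r x = 0 then ⊤
  else (((- ∑ x, margX p x * Real.log (Afun p S r x)) : ℝ) : EReal)

/-- The explicit real-valued formula for `φ_q`:
`∑_x p_x ∑_{j∋x} q_{j|x} log q_{j|x} − ∑_y p^y ∑_j R_{j|y}(q) log R_{j|y}(q)`
(with the convention `0·log 0 = 0`, automatic since `Real.log 0 = 0`). -/
def phiQexp [Fintype X] [Fintype Y] [Fintype J] [DecidableEq X] (p : X → Y → ℝ)
    (S : J → Finset X) (q : J → X → ℝ) : ℝ :=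
  (∑ x, margX p x * ∑ j, if x ∈ S j then q j x * Real.log (q j x) else 0)
    - ∑ y, margY p y * ∑ j, Rmap p S q j y * Real.log (Rmap p S q j y)

/-- The convex corner `K_a := {a : 0 ≤ a_x ≤ A_x(r) (∀x) for some r ∈ K_r}`. -/
def Ka [Fintype X] [Fintype Y] [Fintype J] [DecidableEq X] (p : X → Y → ℝ)
    (S : J → Finset X) : Set (X → ℝ) :=
  {a | ∃ r ∈ Kr J Y, ∀ x, 0 ≤ a x ∧ a x ≤ Afun p S r x}

open Classical in
/-- `φ_a(a) := −∑_x p_x log a_x`, equal to `+∞` if `a_x = 0` for some `x`. -/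
def phiA [Fintype X] [Fintype Y] (p : X → Y → ℝ) (a : X → ℝ) : EReal :=
  if ∃ x, a x = 0 then ⊤
  else (((- ∑ x, margX p x * Real.log (a x)) : ℝ) : EReal)

theorem sub_le_mul_log_sub_mul_log {u v : ℝ} (hu : 0 ≤ u) (hv : 0 ≤ v) (h : v = 0 → u = 0) :
    u - v ≤ u * Real.log u - u * Real.log v := by
  rcases hu.eq_or_lt with rfl | hu
  · simpa using hv
  have hv : 0 < v := lt_of_le_of_ne hv fun h' => hu.ne' (h h'.symm)
  have h1 := mul_le_mul_of_nonneg_left (Real.log_le_sub_one_of_pos (div_pos hv hu)) hu.le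
  rw [Real.log_div hv.ne' hu.ne', mul_sub, mul_sub, mul_div_cancel₀ _ hu.ne'] at h1
  linarith

theorem neg_log_sum_le {ι : Type*} [Fintype ι] {u w : ι → ℝ} (hu : ∀ i, 0 ≤ u i)
    (hw : ∀ i, 0 ≤ w i) (hsum : ∑ i, u i = 1) (h : ∀ i, w i = 0 → u i = 0)
    (hW : ∑ i, w i ≠ 0) :
    -Real.log (∑ i, w i) ≤ ∑ i, (u i * Real.log (u i) - u i * Real.log (w i)) := by
  have hW' : 0 < ∑ i, w i := lt_of_le_of_ne (sum_nonneg fun i _ => hw i) hW.symm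
  have key : ∀ i, u i - w i / (∑ i, w i) - u i * Real.log (∑ i, w i) ≤
      u i * Real.log (u i) - u i * Real.log (w i) := fun i => by
    by_cases hi : w i = 0
    · simp [hi, h i hi]
    have := sub_le_mul_log_sub_mul_log (hu i) (div_nonneg (hw i) hW'.le)
      (fun h' => absurd h' (div_ne_zero hi hW))
    rw [Real.log_div hi hW] at this
    linarith
  refine le_trans (le_of_eq ?_) (sum_le_sum fun i _ => key i)
  rw [sum_sub_distrib, sum_sub_distrib, ← sum_mul, ← sum_div, hsum, div_self hW]
  ring

theorem EReal.sum_eq_top {ι : Type*} [Fintype ι] {f : ι → EReal} (hf : ∀ i, f i ≠ ⊥) {i : ι}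
    (hi : f i = ⊤) : ∑ i, f i = ⊤ := by
  classical
  rw [← add_sum_erase _ _ (mem_univ i), hi, EReal.top_add_of_ne_bot]
  exact sum_induction _ (· ≠ ⊥) (fun a b ha hb => by simp [EReal.add_eq_bot_iff, ha, hb])
    (by simp) fun i _ => hf i

theorem EReal.sum_ne_bot {ι : Type*} [Fintype ι] {f : ι → EReal} (hf : ∀ i, f i ≠ ⊥) :
    ∑ i, f i ≠ ⊥ :=
  sum_induction _ (· ≠ ⊥) (fun a b ha hb => by simp [EReal.add_eq_bot_iff, ha, hb])
    (by simp) fun i _ => hf i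

theorem EReal.coe_sum_univ {ι : Type*} [Fintype ι] (f : ι → ℝ) :
    ((∑ i, f i : ℝ) : EReal) = ∑ i, (f i : EReal) := by
  classical
  exact map_sum (⟨⟨Real.toEReal, EReal.coe_zero⟩, EReal.coe_add⟩ : ℝ →+ EReal) f univ

/-- The pair `(q, r)` has no atom where `φ` is infinite. -/
def FiniteAt (p : X → Y → ℝ) (q : J → X → ℝ) (r : J → Y → ℝ) : Prop :=
  ∀ x y j, r j y = 0 → p x y = 0 ∨ q j x = 0

theorem phi_eq_coe [Fintype X] [Fintype Y] [Fintype J] {p : X → Y → ℝ} {q : J → X → ℝ}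
    {r : J → Y → ℝ} (h : FiniteAt p q r) :
    phi p q r = ((∑ x, ∑ y, ∑ j, p x y * (q j x * Real.log (q j x) - q j x * Real.log (r j y)) :
      ℝ) : EReal) := by
  simp only [phi, EReal.coe_sum_univ]
  refine sum_congr rfl fun x _ => sum_congr rfl fun y _ => sum_congr rfl fun j _ => ?_
  rw [EReal.coe_mul, fdiv]
  split_ifs with hq hr
  · simp [hq]
  · simp [(h x y j hr).resolve_right hq]
  · rfl

theorem phi_eq_top [Fintype X] [Fintype Y] [Fintype J] {p : X → Y → ℝ} (hp : ∀ x y, 0 ≤ p x y)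
    {q : J → X → ℝ} {r : J → Y → ℝ}
    (h : ¬ FiniteAt p q r) : phi p q r = ⊤ := by
  have hbot : ∀ x y j, (p x y : EReal) * fdiv (q j x) (r j y) ≠ ⊥ := fun x y j => by
    rcases (hp x y).eq_or_lt with h0 | h0
    · simp [← h0]
    rw [fdiv]
    split_ifs
    · simp
    · simp [EReal.coe_mul_top_of_pos h0]
    · rw [← EReal.coe_mul]
      exact EReal.coe_ne_bot _
  simp only [FiniteAt, not_forall, not_or] at h
  obtain ⟨x, y, j, hr, hpxy, hq⟩ := h
  refine EReal.sum_eq_top (fun x => EReal.sum_ne_bot fun y => EReal.sum_ne_bot (hbot x y))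
    (i := x) (EReal.sum_eq_top (fun y => EReal.sum_ne_bot (hbot x y)) (i := y)
      (EReal.sum_eq_top (hbot x y) (i := j) ?_))
  rw [fdiv, if_neg hq, if_pos hr, EReal.coe_mul_top_of_pos (lt_of_le_of_ne (hp x y) (Ne.symm hpxy))]

theorem sum_eq_one_of_mem_Kq [Fintype J] [DecidableEq X] {S : J → Finset X} {q : J → X → ℝ}
    (hq : q ∈ Kq S) (x : X) :
    ∑ j, q j x = 1 := by
  rw [← hq.2.1 x]
  refine sum_congr rfl fun j _ => ?_
  split_ifs with hx
  exacts [rfl, hq.2.2 j x hx]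

theorem margY_mul_Rmap [Fintype X] [Fintype Y] [Fintype J] [DecidableEq X] {p : X → Y → ℝ}
    (hpy : ∀ y, 0 < margY p y) {S : J → Finset X}
    {q : J → X → ℝ} (hq : q ∈ Kq S) (j : J) (y : Y) :
    margY p y * Rmap p S q j y = ∑ x, p x y * q j x := by
  rw [Rmap, mul_sum]
  refine sum_congr rfl fun x _ => ?_
  split_ifs with hx
  · rw [← mul_assoc, mul_div_cancel₀ _ (hpy y).ne']
  · simp [hq.2.2 j x hx]

theorem Rmap_mem_Kr [Fintype X] [Fintype Y] [Fintype J] [DecidableEq X] {p : X → Y → ℝ}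
    (hp : ∀ x y, 0 ≤ p x y) (hpy : ∀ y, 0 < margY p y)
    {S : J → Finset X} {q : J → X → ℝ} (hq : q ∈ Kq S) : Rmap p S q ∈ Kr J Y := by
  refine ⟨fun j y => sum_nonneg fun x _ => ?_, fun y => ?_⟩
  · split_ifs
    exacts [mul_nonneg (div_nonneg (hp x y) (hpy y).le) (hq.1 j x), le_rfl]
  · apply mul_left_cancel₀ (hpy y).ne'
    simp only [mul_sum, margY_mul_Rmap hpy hq]
    rw [sum_comm]
    simp only [← mul_sum, sum_eq_one_of_mem_Kq hq, mul_one, margY]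

theorem finiteAt_Rmap [Fintype X] [Fintype Y] [Fintype J] [DecidableEq X] {p : X → Y → ℝ}
    (hp : ∀ x y, 0 ≤ p x y) (hpy : ∀ y, 0 < margY p y)
    {S : J → Finset X} {q : J → X → ℝ} (hq : q ∈ Kq S) : FiniteAt p q (Rmap p S q) := by
  intro x y j h
  have h1 := margY_mul_Rmap hpy hq j y
  rw [h, mul_zero, eq_comm, sum_eq_zero_iff_of_nonneg fun x _ => mul_nonneg (hp x y) (hq.1 j x)]
    at h1
  exact mul_eq_zero.1 (h1 x (mem_univ x))

theorem sum_mul_log_eq_sub [Fintype X] [Fintype Y] [Fintype J] [DecidableEq X] {p : X → Y → ℝ}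
    (hpy : ∀ y, 0 < margY p y) {S : J → Finset X}
    {q : J → X → ℝ} (hq : q ∈ Kq S) (r : J → Y → ℝ) :
    ∑ x, ∑ y, ∑ j, p x y * (q j x * Real.log (q j x) - q j x * Real.log (r j y)) =
      ∑ x, margX p x * ∑ j, q j x * Real.log (q j x) -
        ∑ y, margY p y * ∑ j, Rmap p S q j y * Real.log (r j y) := by
  simp only [mul_sub, sum_sub_distrib]
  congr 1
  · refine sum_congr rfl fun x _ => ?_
    simp only [margX, sum_mul, mul_sum]
    exact sum_comm
  · rw [sum_comm]
    refine sum_congr rfl fun y _ => ?_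
    simp only [mul_sum, ← mul_assoc, margY_mul_Rmap hpy hq, sum_mul]
    rw [sum_comm]

theorem phi_Rmap_le [Fintype X] [Fintype Y] [Fintype J] [DecidableEq X] {p : X → Y → ℝ}
    (hp : ∀ x y, 0 ≤ p x y) (hpy : ∀ y, 0 < margY p y)
    {S : J → Finset X} {q : J → X → ℝ} (hq : q ∈ Kq S) {r : J → Y → ℝ} (hr : r ∈ Kr J Y) :
    phi p q (Rmap p S q) ≤ phi p q r := by
  by_cases h : FiniteAt p q r
  swap
  · simp [phi_eq_top hp h]
  rw [phi_eq_coe h, phi_eq_coe (finiteAt_Rmap hp hpy hq), EReal.coe_le_coe_iff,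
    sum_mul_log_eq_sub hpy hq, sum_mul_log_eq_sub hpy hq]
  refine sub_le_sub_left (sum_le_sum fun y _ => mul_le_mul_of_nonneg_left ?_ (hpy y).le) _
  have hR := Rmap_mem_Kr hp hpy hq
  rw [← sub_nonneg, ← sum_sub_distrib]
  calc (0 : ℝ) = ∑ j, (Rmap p S q j y - r j y) := by
        rw [sum_sub_distrib, hR.2 y, hr.2 y, sub_self]
    _ ≤ _ := sum_le_sum fun j _ => sub_le_mul_log_sub_mul_log (hR.1 j y) (hr.1 j y) fun h0 => by
        have h1 := margY_mul_Rmap hpy hq j y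
        rw [sum_eq_zero fun x _ => mul_eq_zero.2 (h x y j h0)] at h1
        exact (mul_eq_zero.1 h1).resolve_left (hpy y).ne'

/-- The summands `∏_y (r_{j|y})^{p^{y|x}}`, for `j ∋ x`, of `A_x(r)`. -/
def weight [Fintype Y] [DecidableEq X] (p : X → Y → ℝ) (S : J → Finset X) (r : J → Y → ℝ) (j : J)
    (x : X) : ℝ :=
  if x ∈ S j then ∏ y, r j y ^ (p x y / margX p x) else 0

theorem weight_nonneg [Fintype Y] [Fintype J] [DecidableEq X] (p : X → Y → ℝ) (S : J → Finset X)
    {r : J → Y → ℝ} (hr : r ∈ Kr J Y)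
    (j : J) (x : X) : 0 ≤ weight p S r j x := by
  rw [weight]
  split_ifs
  exacts [prod_nonneg fun y _ => Real.rpow_nonneg (hr.1 j y) _, le_rfl]

theorem rpow_ne_zero_of_finiteAt [Fintype Y] [Fintype J] {p : X → Y → ℝ} {q : J → X → ℝ}
    {r : J → Y → ℝ}
    (hr : r ∈ Kr J Y) (h : FiniteAt p q r) {j : J} {x : X} (hq : q j x ≠ 0) (y : Y) :
    r j y ^ (p x y / margX p x) ≠ 0 := by
  rw [Ne, Real.rpow_eq_zero_iff_of_nonneg (hr.1 j y)]
  rintro ⟨h0, h1⟩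
  exact h1 (by simp [(h x y j h0).resolve_right hq])

theorem weight_ne_zero [Fintype Y] [Fintype J] [DecidableEq X] {p : X → Y → ℝ} {S : J → Finset X}
    {q : J → X → ℝ} (hq : q ∈ Kq S)
    {r : J → Y → ℝ} (hr : r ∈ Kr J Y) (h : FiniteAt p q r) {j : J} {x : X} (hjx : q j x ≠ 0) :
    weight p S r j x ≠ 0 := by
  rw [weight, if_pos (by_contra fun hx => hjx (hq.2.2 j x hx))]
  exact prod_ne_zero_iff.2 fun y _ => rpow_ne_zero_of_finiteAt hr h hjx y

theorem sum_mul_log_eq_weight [Fintype X] [Fintype Y] [Fintype J] [DecidableEq X] {p : X → Y → ℝ}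
    (hpx : ∀ x, 0 < margX p x) {S : J → Finset X}
    {q : J → X → ℝ} (hq : q ∈ Kq S) {r : J → Y → ℝ} (hr : r ∈ Kr J Y) (h : FiniteAt p q r) :
    ∑ x, ∑ y, ∑ j, p x y * (q j x * Real.log (q j x) - q j x * Real.log (r j y)) =
      ∑ x, margX p x * ∑ j, (q j x * Real.log (q j x) - q j x * Real.log (weight p S r j x)) := by
  refine sum_congr rfl fun x _ => ?_
  rw [sum_comm, mul_sum]
  refine sum_congr rfl fun j _ => ?_
  by_cases hjx : q j x = 0
  · simp [hjx]
  have hlog : margX p x * Real.log (weight p S r j x) = ∑ y, p x y * Real.log (r j y) := by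
    rw [weight, if_pos (by_contra fun hx => hjx (hq.2.2 j x hx)),
      Real.log_prod fun y _ => rpow_ne_zero_of_finiteAt hr h hjx y, mul_sum]
    refine sum_congr rfl fun y _ => ?_
    rcases (hr.1 j y).eq_or_lt with h0 | h0
    · simp [(h x y j h0.symm).resolve_right hjx]
    · rw [Real.log_rpow h0, ← mul_assoc, mul_div_cancel₀ _ (hpx x).ne']
  rw [mul_sub, mul_left_comm _ (q j x) (Real.log (weight p S r j x)), hlog]
  simp only [mul_sub, sum_sub_distrib, ← sum_mul, mul_sum, margX]
  congr 1
  exact sum_congr rfl fun y _ => by ring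

theorem phiR_le_phi [Fintype X] [Fintype Y] [Fintype J] [DecidableEq X] {p : X → Y → ℝ}
    (hp : ∀ x y, 0 ≤ p x y) (hpx : ∀ x, 0 < margX p x)
    {S : J → Finset X} {q : J → X → ℝ} (hq : q ∈ Kq S) {r : J → Y → ℝ} (hr : r ∈ Kr J Y) :
    phiR p S r ≤ phi p q r := by
  by_cases h : FiniteAt p q r
  swap
  · simp [phi_eq_top hp h]
  have hA : ∀ x, Afun p S r x ≠ 0 := fun x h0 => by
    change ∑ j, weight p S r j x = 0 at h0
    rw [sum_eq_zero_iff_of_nonneg fun j _ => weight_nonneg p S hr j x] at h0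
    have h1 := sum_eq_one_of_mem_Kq hq x
    rw [sum_eq_zero fun j _ => by_contra fun hj => weight_ne_zero hq hr h hj (h0 j (mem_univ j))]
      at h1
    exact zero_ne_one h1
  rw [phiR, if_neg (not_exists.2 hA), phi_eq_coe h, EReal.coe_le_coe_iff,
    sum_mul_log_eq_weight hpx hq hr h, ← sum_neg_distrib]
  refine sum_le_sum fun x _ => ?_
  rw [← mul_neg]
  exact mul_le_mul_of_nonneg_left (neg_log_sum_le (fun j => hq.1 j x)
    (fun j => weight_nonneg p S hr j x) (sum_eq_one_of_mem_Kq hq x)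
    (fun j => not_imp_not.1 (weight_ne_zero hq hr h)) (hA x)) (hpx x).le

theorem Qmap_eq_weight_div [Fintype Y] [Fintype J] [DecidableEq X] (p : X → Y → ℝ)
    (S : J → Finset X) (r : J → Y → ℝ) (j : J) (x : X) :
    Qmap p S r j x = weight p S r j x / Afun p S r x := by
  rw [Qmap, weight, ite_div, zero_div]

theorem Qmap_mem_Kq [Fintype Y] [Fintype J] [DecidableEq X] {p : X → Y → ℝ} {S : J → Finset X}
    {r : J → Y → ℝ} (hr : r ∈ Kr J Y)
    (hA : ∀ x, Afun p S r x ≠ 0) : Qmap p S r ∈ Kq S := by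
  refine ⟨fun j x => ?_, fun x => ?_, fun j x hx => if_neg hx⟩
  · rw [Qmap_eq_weight_div]
    exact div_nonneg (weight_nonneg p S hr j x) (sum_nonneg fun j _ => weight_nonneg p S hr j x)
  · rw [← div_self (hA x)]
    nth_rw 1 [Afun]
    rw [sum_div]
    refine sum_congr rfl fun j _ => ?_
    split_ifs with hx
    exacts [if_pos hx, (zero_div _).symm]

theorem phi_Qmap [Fintype X] [Fintype Y] [Fintype J] [DecidableEq X] {p : X → Y → ℝ}
    (hpx : ∀ x, 0 < margX p x) {S : J → Finset X}
    {r : J → Y → ℝ} (hr : r ∈ Kr J Y) (hA : ∀ x, Afun p S r x ≠ 0) :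
    phi p (Qmap p S r) r = phiR p S r := by
  have hQ := Qmap_mem_Kq hr hA
  have h : FiniteAt p (Qmap p S r) r := fun x y j h0 => by
    refine or_iff_not_imp_left.2 fun hpxy => ?_
    rw [Qmap, prod_eq_zero (mem_univ y)]
    · simp
    · rw [h0, Real.zero_rpow (div_ne_zero hpxy (hpx x).ne')]
  rw [phiR, if_neg (not_exists.2 hA), phi_eq_coe h, sum_mul_log_eq_weight hpx hQ hr h,
    ← sum_neg_distrib]
  congr 1
  refine sum_congr rfl fun x _ => ?_
  rw [← mul_neg, ← one_mul (-Real.log (Afun p S r x)), ← sum_eq_one_of_mem_Kq hQ x, sum_mul]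
  congr 1
  refine sum_congr rfl fun j _ => ?_
  by_cases hw : weight p S r j x = 0
  · simp [Qmap_eq_weight_div, hw]
  nth_rw 2 [Qmap_eq_weight_div]
  rw [Real.log_div hw (hA x)]
  ring

theorem isCompact_Kq [Fintype J] [DecidableEq X] (S : J → Finset X) : IsCompact (Kq S) := by
  refine (isCompact_Icc (a := (0 : J → X → ℝ)) (b := 1)).of_isClosed_subset ?_ ?_
  · simp only [Kq, Set.ofPred_and, Set.ofPred_forall]
    refine IsClosed.inter ?_ (IsClosed.inter ?_ ?_)
    · exact isClosed_iInter fun j => isClosed_iInter fun x =>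
        isClosed_le continuous_const (by fun_prop)
    · refine isClosed_iInter fun x => isClosed_eq (continuous_finsetSum _ fun j _ => ?_)
        continuous_const
      split_ifs <;> fun_prop
    · exact isClosed_iInter fun j => isClosed_iInter fun x => isClosed_iInter fun _ =>
        isClosed_eq (by fun_prop) continuous_const
  · exact fun q hq => ⟨hq.1, fun j x => (single_le_sum (f := fun j => q j x)
      (fun j _ => hq.1 j x) (mem_univ j)).trans_eq (sum_eq_one_of_mem_Kq hq x)⟩

theorem Kq_nonempty [Fintype J] [DecidableEq X] {S : J → Finset X} (hcov : ∀ x, ∃ j, x ∈ S j) :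
    (Kq S).Nonempty := by
  classical
  choose c hc using hcov
  refine ⟨fun j x => if j = c x then 1 else 0, fun j x => ?_, fun x => ?_, fun j x hx => ?_⟩
  · dsimp only
    split_ifs <;> simp
  · rw [sum_eq_single (c x)] <;> simp +contextual [hc]
  · exact if_neg fun h : j = c x => hx (h ▸ hc x)

theorem exists_forall_phi_Rmap_le [Fintype X] [Fintype Y] [Fintype J] [DecidableEq X]
    {p : X → Y → ℝ} (hp : ∀ x y, 0 ≤ p x y)
    (hpy : ∀ y, 0 < margY p y) {S : J → Finset X} (hcov : ∀ x, ∃ j, x ∈ S j) :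
    ∃ q₀ ∈ Kq S, ∀ q ∈ Kq S, phi p q₀ (Rmap p S q₀) ≤ phi p q (Rmap p S q) := by
  have hR : ∀ j y, Continuous fun q : J → X → ℝ => Rmap p S q j y := fun j y =>
    continuous_finsetSum _ fun x _ => by split_ifs <;> fun_prop
  have hcont : Continuous fun q : J → X → ℝ =>
      ∑ x, margX p x * ∑ j, q j x * Real.log (q j x) -
        ∑ y, margY p y * ∑ j, Rmap p S q j y * Real.log (Rmap p S q j y) := by
    refine (continuous_finsetSum _ fun x _ => continuous_const.mul <|
      continuous_finsetSum _ fun j _ => ?_).sub (continuous_finsetSum _ fun y _ =>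
        continuous_const.mul <| continuous_finsetSum _ fun j _ => ?_)
    · exact Real.continuous_mul_log.comp (by fun_prop : Continuous fun q : J → X → ℝ => q j x)
    · exact Real.continuous_mul_log.comp (hR j y)
  obtain ⟨q₀, hq₀, hmin⟩ := (isCompact_Kq S).exists_isMinOn (Kq_nonempty hcov) hcont.continuousOn
  refine ⟨q₀, hq₀, fun q hq => ?_⟩
  rw [phi_eq_coe (finiteAt_Rmap hp hpy hq₀), phi_eq_coe (finiteAt_Rmap hp hpy hq),
    EReal.coe_le_coe_iff, sum_mul_log_eq_sub hpy hq₀, sum_mul_log_eq_sub hpy hq]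
  exact hmin hq

/-- the three minima coincide and are attained:
`min_{(q,r) ∈ K_q × K_r} φ(q,r) = min_{q ∈ K_q} φ_q(q) = min_{r ∈ K_r} φ_r(r)`,
where `φ_q(q) := φ(q, R(q))`. -/
theorem three_minima_coincide (X Y J : Type*) [Fintype X] [Fintype Y] [Fintype J]
    [Nonempty X] [Nonempty Y] [DecidableEq X]
    (p : X → Y → ℝ) (S : J → Finset X)
    (hp : ∀ x y, 0 ≤ p x y) (hptot : ∑ x, ∑ y, p x y = 1)
    (hpx : ∀ x, 0 < margX p x) (hpy : ∀ y, 0 < margY p y)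
    (hcov : ∀ x, ∃ j, x ∈ S j) :
    ∃ q0 ∈ Kq S, ∃ r0 ∈ Kr J Y, ∃ q1 ∈ Kq S, ∃ r1 ∈ Kr J Y,
      (∀ q ∈ Kq S, ∀ r ∈ Kr J Y, phi p q0 r0 ≤ phi p q r) ∧
      (∀ q ∈ Kq S, phi p q1 (Rmap p S q1) ≤ phi p q (Rmap p S q)) ∧
      (∀ r ∈ Kr J Y, phiR p S r1 ≤ phiR p S r) ∧
      phi p q0 r0 = phi p q1 (Rmap p S q1) ∧
      phi p q1 (Rmap p S q1) = phiR p S r1 := by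
  obtain ⟨q₀, hq₀, hmin⟩ := exists_forall_phi_Rmap_le hp hpy hcov
  have hr₀ := Rmap_mem_Kr hp hpy hq₀
  have hle : ∀ r ∈ Kr J Y, phi p q₀ (Rmap p S q₀) ≤ phiR p S r := fun r hr => by
    by_cases hA : ∃ x, Afun p S r x = 0
    · simp [phiR, if_pos hA]
    have hA := not_exists.1 hA
    have hQ := Qmap_mem_Kq hr hA
    rw [← phi_Qmap hpx hr hA]
    exact (hmin _ hQ).trans (phi_Rmap_le hp hpy hQ hr)
  have hge := phiR_le_phi hp hpx hq₀ hr₀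
  exact ⟨q₀, hq₀, Rmap p S q₀, hr₀, q₀, hq₀, Rmap p S q₀, hr₀,
    fun q hq r hr => (hmin q hq).trans (phi_Rmap_le hp hpy hq hr), hmin,
    fun r hr => hge.trans (hle r hr), rfl, le_antisymm (hle _ hr₀) hge⟩
end
end

section
/- (3-point property.) For every q ∈ K_q and every r ∈ K_r with A_x(r) > 0 for all x, the identity φ(q,r) = δ(q, Q(r)) + φ_r(r) holds in the extended reals. -/
noncomputable section

open Finset

variable {X Y J : Type*}

theorem EReal.coe_finset_sum {ι : Type*} (s : Finset ι) (f : ι → ℝ) :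
    ((∑ i ∈ s, f i : ℝ) : EReal) = ∑ i ∈ s, (f i : EReal) := by
  classical
  induction s using Finset.induction_on with
  | empty => simp
  | insert a s ha ih => rw [sum_insert ha, sum_insert ha, EReal.coe_add, ih]

theorem EReal.finset_sum_ne_bot {ι : Type*} (s : Finset ι) (f : ι → EReal)
    (h : ∀ i ∈ s, f i ≠ ⊥) : ∑ i ∈ s, f i ≠ ⊥ := by
  classical
  induction s using Finset.induction_on with
  | empty => simp
  | insert a s ha ih =>
    rw [sum_insert ha, Ne, EReal.add_eq_bot_iff, not_or]
    exact ⟨h a (mem_insert_self a s), ih fun i hi => h i (mem_insert_of_mem hi)⟩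

theorem EReal.finset_sum_eq_top {ι : Type*} {s : Finset ι} {f : ι → EReal}
    (h : ∀ i ∈ s, f i ≠ ⊥) {a : ι} (ha : a ∈ s) (hfa : f a = ⊤) : ∑ i ∈ s, f i = ⊤ := by
  classical
  rw [← add_sum_erase s f ha, hfa]
  exact EReal.top_add_of_ne_bot
    (EReal.finset_sum_ne_bot _ _ fun i hi => h i (mem_of_mem_erase hi))

theorem EReal.coe_mul_finset_sum {ι : Type*} (s : Finset ι) (f : ι → EReal) {c : ℝ}
    (hc : 0 ≤ c) : (c : EReal) * ∑ i ∈ s, f i = ∑ i ∈ s, (c : EReal) * f i := by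
  classical
  induction s using Finset.induction_on with
  | empty => simp
  | insert a s ha ih =>
    rw [sum_insert ha, sum_insert ha, ← ih,
      EReal.left_distrib_of_nonneg_of_ne_top (by exact_mod_cast hc) (EReal.coe_ne_top c)]

theorem coe_mul_fdiv_ne_bot {c : ℝ} (hc : 0 ≤ c) (u v : ℝ) : (c : EReal) * fdiv u v ≠ ⊥ := by
  unfold fdiv
  split_ifs
  · simp
  · rcases hc.eq_or_lt with rfl | hc
    · simp
    · simp [EReal.coe_mul_top_of_pos hc]
  · rw [← EReal.coe_mul]
    exact EReal.coe_ne_bot _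

/-- For weights `c` of positive total mass, averaging `fdiv u (v y)` amounts to evaluating `fdiv`
at the weighted geometric mean of `v`; dividing that mean by `A > 0` shifts the value by
`u * log A`. -/
theorem sum_coe_mul_fdiv [Fintype Y] (c v : Y → ℝ) (hc : ∀ y, 0 ≤ c y) (hm : 0 < ∑ y, c y)
    (hv : ∀ y, 0 ≤ v y) (u : ℝ) {A : ℝ} (hA : 0 < A) :
    ∑ y, (c y : EReal) * fdiv u (v y) =
      ((∑ y, c y : ℝ) : EReal) * fdiv u ((∏ y, v y ^ (c y / ∑ z, c z)) / A) +
        ((-((∑ y, c y) * (u * Real.log A)) : ℝ) : EReal) := by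
  set m := ∑ y, c y with hmdef
  by_cases hu : u = 0
  · simp [fdiv, hu]
  by_cases hw : ∏ y, v y ^ (c y / m) = 0
  · obtain ⟨y, -, hy⟩ := prod_eq_zero_iff.mp hw
    obtain ⟨hvy, hcy⟩ := (Real.rpow_eq_zero_iff_of_nonneg (hv y)).mp hy
    have hcy : 0 < c y := (hc y).lt_of_ne fun h => hcy (by rw [← h, zero_div])
    rw [EReal.finset_sum_eq_top (fun i _ => coe_mul_fdiv_ne_bot (hc i) u (v i)) (mem_univ y)
      (by simp [fdiv, hu, hvy, EReal.coe_mul_top_of_pos hcy])]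
    rw [hw, zero_div, fdiv, if_neg hu, if_pos rfl, EReal.coe_mul_top_of_pos hm,
      EReal.top_add_coe]
  · have hne : ∀ y, v y ^ (c y / m) ≠ 0 := fun y => prod_ne_zero_iff.mp hw y (mem_univ y)
    have hterm : ∀ y, (c y : EReal) * fdiv u (v y) =
        ((c y * (u * Real.log u - u * Real.log (v y)) : ℝ) : EReal) := by
      intro y
      by_cases hvy : v y = 0
      · have hcy : c y = 0 := by
          by_contra h
          exact hne y (by rw [hvy, Real.zero_rpow (div_ne_zero h hm.ne')])
        simp [hcy]
      · rw [fdiv, if_neg hu, if_neg hvy, EReal.coe_mul]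
    have hlog : m * Real.log (∏ y, v y ^ (c y / m)) = ∑ y, c y * Real.log (v y) := by
      rw [Real.log_prod fun y _ => hne y, mul_sum]
      refine sum_congr rfl fun y _ => ?_
      rcases (hv y).eq_or_lt with h | h
      · have hcy : c y = 0 := by
          by_contra hcy
          exact hne y (by rw [← h, Real.zero_rpow (div_ne_zero hcy hm.ne')])
        simp [hcy]
      · rw [Real.log_rpow h]
        field_simp
    rw [sum_congr rfl fun y _ => hterm y, ← EReal.coe_finset_sum, fdiv, if_neg hu,
      if_neg (div_ne_zero hw hA.ne'), ← EReal.coe_mul, ← EReal.coe_add, EReal.coe_eq_coe_iff,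
      Real.log_div hw hA.ne']
    have hsum : ∑ y, c y * (u * Real.log u - u * Real.log (v y)) =
        m * (u * Real.log u) - u * ∑ y, c y * Real.log (v y) := by
      rw [hmdef, sum_mul, mul_sum, ← sum_sub_distrib]
      exact sum_congr rfl fun y _ => by ring
    rw [hsum, ← hlog]
    ring

/-- 3-point property: for every `q ∈ K_q` and every `r ∈ K_r` with `A_x(r) > 0`
for all `x`, the identity `φ(q,r) = δ(q, Q(r)) + φ_r(r)` holds in the extended reals. -/
theorem three_point_property (X Y J : Type*) [Fintype X] [Fintype Y] [Fintype J]
    [Nonempty X] [Nonempty Y] [DecidableEq X]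
    (p : X → Y → ℝ) (S : J → Finset X)
    (hp : ∀ x y, 0 ≤ p x y) (hptot : ∑ x, ∑ y, p x y = 1)
    (hpx : ∀ x, 0 < margX p x) (hpy : ∀ y, 0 < margY p y)
    (hcov : ∀ x, ∃ j, x ∈ S j) :
    ∀ q ∈ Kq S, ∀ r ∈ Kr J Y, (∀ x, 0 < Afun p S r x) →
      phi p q r = delta p S q (Qmap p S r) + phiR p S r := by
  rintro q ⟨-, hq1, hq0⟩ r ⟨hr, -⟩ hA
  have hphiR : phiR p S r = ∑ x, ((-(margX p x * Real.log (Afun p S r x)) : ℝ) : EReal) := by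
    rw [phiR, if_neg (by rintro ⟨x, hx⟩; exact (hA x).ne' hx), ← sum_neg_distrib,
      EReal.coe_finset_sum]
  rw [hphiR, phi, delta, ← sum_add_distrib]
  refine sum_congr rfl fun x _ => ?_
  have hq1x : ∑ j, q j x = 1 := by
    rw [← hq1 x]
    refine sum_congr rfl fun j _ => ?_
    split_ifs with h
    · rfl
    · exact hq0 j x h
  have hsplit : -(margX p x * Real.log (Afun p S r x)) =
      ∑ j, -(margX p x * (q j x * Real.log (Afun p S r x))) := by
    rw [sum_neg_distrib, ← mul_sum, ← sum_mul, hq1x, one_mul]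
  rw [sum_comm, EReal.coe_mul_finset_sum _ _ (hpx x).le, hsplit, EReal.coe_finset_sum,
    ← sum_add_distrib]
  refine sum_congr rfl fun j _ => ?_
  by_cases hj : x ∈ S j
  · rw [if_pos hj, Qmap, if_pos hj]
    exact sum_coe_mul_fdiv (p x) (r j) (hp x) (hpx x) (hr j) (q j x) (hA x)
  · simp [hj, hq0 j x hj, fdiv]
end
end
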